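/- Let U be a countable set, let C : ℕ → Set U be a language collection with every C i nonempty, let k ≥ 1, and let p ∈ [0,1]. If there exists a probabilistic k-list identifier that identifies C in the limit with probability p, then there exists a deterministic k-list identifier that identifies C in the limit with probability p on infinite draws. -/

import Mathlib

open MeasureTheory

/-- `x : ℕ → U` is an enumeration of the language `L ⊆ U`. -/
def IsEnumeration {U : Type*} (L : Set U) (x : ℕ → U) : Prop :=
  (∀ n, x n ∈ L) ∧ ∀ u ∈ L, ∃ n, x n = u

/-- The finite sequence consisting of the first `t` values of `x`. -/
def prefixList {U : Type*} (x : ℕ → U) (t : ℕ) : List U :=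
  List.ofFn (fun j : Fin t => x j)

/-- `A` is a `k`-list identifier that identifies the collection `C` in the limit. -/
def IdentifiesInLimit {U : Type*} (C : ℕ → Set U) (k : ℕ) (A : List U → Finset ℕ) : Prop :=
  (∀ s, (A s).card ≤ k) ∧
  ∀ z : ℕ, ∀ x : ℕ → U, IsEnumeration (C z) x →
    ∃ tStar : ℕ, ∀ t ≥ tStar, ∃ i ∈ A (prefixList x t), C i = C z

/-- The collection `C` is `k`-list identifiable in the limit. -/
def ListIdentifiable {U : Type*} (C : ℕ → Set U) (k : ℕ) : Prop :=
  ∃ A : List U → Finset ℕ, IdentifiesInLimit C k A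

/-- `μ` is the infinite product of fair-coin (Bernoulli(1/2)) measures on `{0,1}^ℕ`:
it is a probability measure giving every cylinder of length `t` measure `2⁻ᵗ`. -/
def IsBernoulliProduct (μ : Measure (ℕ → Bool)) : Prop :=
  IsProbabilityMeasure μ ∧
  ∀ (t : ℕ) (b : Fin t → Bool),
    μ {r : ℕ → Bool | ∀ j : Fin t, r (j : ℕ) = b j} = (2 : ENNReal)⁻¹ ^ t

/-- The probabilistic `k`-list identifier `B` identifies `C` in the limit with
probability (at least) `p`. -/
def ProbIdentifiesInLimit {U : Type*} (C : ℕ → Set U) (k : ℕ)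
    (B : List (U × Bool) → Finset ℕ) (p : ENNReal) : Prop :=
  (∀ s, (B s).card ≤ k) ∧
  ∀ z : ℕ, ∀ x : ℕ → U, IsEnumeration (C z) x →
    ∀ μ : Measure (ℕ → Bool), IsBernoulliProduct μ →
      p ≤ μ {r : ℕ → Bool | ∃ tStar : ℕ, ∀ t ≥ tStar,
        ∃ i ∈ B (List.ofFn fun j : Fin t => (x (j : ℕ), r (j : ℕ))), C i = C z}

/-- The probability distribution `D` on `U` is valid for the language `L`:
`D({u}) > 0` if and only if `u ∈ L`. -/
def IsValidFor {U : Type*} [MeasurableSpace U] (D : Measure U) (L : Set U) : Prop :=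
  IsProbabilityMeasure D ∧ ∀ u : U, 0 < D {u} ↔ u ∈ L

/-- `μ` is the infinite i.i.d. product `D^∞` on `U^ℕ` of the distribution `D`:
it is a probability measure whose finite-dimensional cylinder marginals are products of
`D`. -/
def IsIIDProduct {U : Type*} [MeasurableSpace U] (D : Measure U)
    (μ : Measure (ℕ → U)) : Prop :=
  IsProbabilityMeasure μ ∧
  ∀ (t : ℕ) (S : Fin t → Set U),
    μ {f : ℕ → U | ∀ j : Fin t, f (j : ℕ) ∈ S j} = ∏ j : Fin t, D (S j)

/-- The deterministic `k`-list identifier `A` identifies `C` in the limit with probability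
(at least) `p` on infinite draws. -/
def IdentifiesOnDraws {U : Type*} [MeasurableSpace U] (C : ℕ → Set U) (k : ℕ)
    (A : List U → Finset ℕ) (p : ENNReal) : Prop :=
  (∀ s, (A s).card ≤ k) ∧
  ∀ z : ℕ, ∀ D : Measure U, IsValidFor D (C z) →
    ∀ μ : Measure (ℕ → U), IsIIDProduct D μ →
      p ≤ μ {x : ℕ → U | ∃ tStar : ℕ, ∀ t ≥ tStar,
        ∃ i ∈ A (prefixList x t), C i = C z}

open Classical in
/-- Von Neumann extraction from the first `N` blocks `x (3 * n), x (3 * n + 1), x (3 * n + 2)` of `x`: each block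
whose last two entries differ contributes a bit recording their order (with respect to `e`), and the
`m`-th extracted bit is paired with the `m`-th first entry `x (3 * m)`. -/
noncomputable def extractFlips {U : Type*} (e : U → ℕ) (x : ℕ → U) : ℕ → List (U × Bool)
  | 0 => []
  | n + 1 =>
    if x (3 * n + 1) ≠ x (3 * n + 2) then
      extractFlips e x n ++
        [(x (3 * (extractFlips e x n).length), decide (e (x (3 * n + 1)) < e (x (3 * n + 2))))]
    else extractFlips e x n

lemma extractFlips_eq_ofFn {U : Type*} (e : U → ℕ) (x : ℕ → U) (P : ℕ → Prop) [DecidablePred P]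
    (hP : ∀ n, P n ↔ x (3 * n + 1) ≠ x (3 * n + 2)) (b : ℕ → Bool)
    (hb : ∀ n, P n → decide (e (x (3 * n + 1)) < e (x (3 * n + 2))) = b n) (n : ℕ) :
    extractFlips e x n =
      List.ofFn fun j : Fin (Nat.count P n) => (x (3 * (j : ℕ)), b (Nat.nth P j)) := by
  induction n with
  | zero => simp [extractFlips]
  | succ n ih =>
    by_cases h : P n
    · have hc : Nat.count P (n + 1) = Nat.count P n + 1 := by rw [Nat.count_succ, if_pos h]
      have hl : (extractFlips e x n).length = Nat.count P n := by rw [ih, List.length_ofFn]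
      rw [extractFlips, if_pos ((hP n).1 h), hl, hb n h, ih, hc, List.ofFn_succ',
        List.concat_eq_append]
      simp only [Fin.val_last, Nat.nth_count h, Fin.val_castSucc]
    · have hc : Nat.count P (n + 1) = Nat.count P n := by rw [Nat.count_succ, if_neg h, add_zero]
      rw [extractFlips, if_neg (mt (hP n).2 h), ih, hc]

lemma length_extractFlips_le {U : Type*} (e : U → ℕ) (x : ℕ → U) (n : ℕ) :
    (extractFlips e x n).length ≤ n := by
  induction n with
  | zero => simp [extractFlips]
  | succ n ih =>
    rw [extractFlips]
    split_ifs
    · simpa using ih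
    · exact ih.trans n.le_succ

lemma extractFlips_congr {U : Type*} (e : U → ℕ) {x y : ℕ → U} (n : ℕ)
    (h : ∀ i < 3 * n, x i = y i) : extractFlips e x n = extractFlips e y n := by
  induction n with
  | zero => rfl
  | succ n ih =>
    have ih := ih fun i hi => h i (by omega)
    have hl := length_extractFlips_le e y n
    simp only [extractFlips]
    rw [ih, h (3 * n + 1) (by omega), h (3 * n + 2) (by omega),
      h (3 * (extractFlips e y n).length) (by omega)]

open Classical in
/-- The deterministic identifier that answers with an index of the set of observed elements if that
set is a trivial language, and otherwise runs `B` on the flips extracted from the sample. -/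
noncomputable def derandomize {U : Type*} [Inhabited U] (C : ℕ → Set U)
    (B : List (U × Bool) → Finset ℕ) (e : U → ℕ) (s : List U) : Finset ℕ :=
  if h : ∃ i, (C i).Subsingleton ∧ C i = {v | v ∈ s} then {h.choose}
  else B (extractFlips e (fun n => s.getD n default) (s.length / 3))

lemma mem_prefixList {U : Type*} {x : ℕ → U} {t : ℕ} {u : U} :
    u ∈ prefixList x t ↔ ∃ n < t, x n = u := by
  simp only [prefixList, List.mem_ofFn]
  exact ⟨fun ⟨j, hj⟩ => ⟨j, j.2, hj⟩, fun ⟨n, hn, h⟩ => ⟨⟨n, hn⟩, h⟩⟩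

lemma card_derandomize_le {U : Type*} [Inhabited U] {C : ℕ → Set U} {k : ℕ} (hk : 1 ≤ k)
    {B : List (U × Bool) → Finset ℕ} (hB : ∀ s, (B s).card ≤ k) (e : U → ℕ) (s : List U) :
    (derandomize C B e s).card ≤ k := by
  unfold derandomize
  split_ifs
  · simpa using hk
  · exact hB _

lemma derandomize_of_subsingleton {U : Type*} [Inhabited U] {C : ℕ → Set U}
    (B : List (U × Bool) → Finset ℕ) (e : U → ℕ) {z : ℕ} (hz : (C z).Subsingleton) {x : ℕ → U}
    (hx : IsEnumeration (C z) x) {t : ℕ} (ht : 1 ≤ t) :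
    ∃ i ∈ derandomize C B e (prefixList x t), C i = C z := by
  have hs : C z = {v | v ∈ prefixList x t} := by
    ext u
    rw [Set.mem_ofPred_eq, mem_prefixList]
    exact ⟨fun hu => ⟨0, ht, hz (hx.1 0) hu⟩, fun ⟨n, _, h⟩ => h ▸ hx.1 n⟩
  have h : ∃ i, (C i).Subsingleton ∧ C i = {v | v ∈ prefixList x t} := ⟨z, hz, hs⟩
  refine ⟨h.choose, ?_, h.choose_spec.2.trans hs.symm⟩
  rw [derandomize, dif_pos h]
  exact Finset.mem_singleton_self _

lemma derandomize_prefixList {U : Type*} [Inhabited U] (C : ℕ → Set U)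
    (B : List (U × Bool) → Finset ℕ) (e : U → ℕ) {x : ℕ → U} {t m n : ℕ} (hm : m < t) (hn : n < t)
    (h : x m ≠ x n) :
    derandomize C B e (prefixList x t) = B (extractFlips e x (t / 3)) := by
  rw [derandomize, dif_neg]
  · have hl : (prefixList x t).length = t := by simp [prefixList]
    rw [hl, extractFlips_congr e (t / 3)]
    intro i hi
    have hi' : i < t := by omega
    simp [prefixList, hi']
  · rintro ⟨i, hi, hs⟩
    refine h (hi ?_ ?_) <;> rw [hs, Set.mem_ofPred_eq, mem_prefixList]
    exacts [⟨m, hm, rfl⟩, ⟨n, hn, rfl⟩]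

/-- The involution of `ℕ` exchanging `3 * n + 1` and `3 * n + 2` whenever `r n` is true. -/
def pairSwap (r : ℕ → Bool) (n : ℕ) : ℕ :=
  if r (n / 3) then if n % 3 = 1 then n + 1 else if n % 3 = 2 then n - 1 else n else n

lemma pairSwap_involutive (r : ℕ → Bool) : Function.Involutive (pairSwap r) := by
  intro n
  unfold pairSwap
  by_cases h : r (n / 3)
  · by_cases h1 : n % 3 = 1
    · have : (n + 1) / 3 = n / 3 := by omega
      have : (n + 1) % 3 = 2 := by omega
      simp [*]
    · by_cases h2 : n % 3 = 2
      · have : (n - 1) / 3 = n / 3 := by omega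
        have : (n - 1) % 3 = 1 := by omega
        simp [*]
        omega
      · simp [*]
  · simp [h]

lemma pairSwap_three_mul (r : ℕ → Bool) (n : ℕ) : pairSwap r (3 * n) = 3 * n := by
  simp [pairSwap]

lemma pairSwap_one (r : ℕ → Bool) (n : ℕ) :
    pairSwap r (3 * n + 1) = if r n then 3 * n + 2 else 3 * n + 1 := by
  have h1 : (3 * n + 1) / 3 = n := by omega
  have h2 : (3 * n + 1) % 3 = 1 := by omega
  simp [pairSwap, h1, h2]

lemma pairSwap_two (r : ℕ → Bool) (n : ℕ) :
    pairSwap r (3 * n + 2) = if r n then 3 * n + 1 else 3 * n + 2 := by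
  have h1 : (3 * n + 2) / 3 = n := by omega
  have h2 : (3 * n + 2) % 3 = 2 := by omega
  simp [pairSwap, h1, h2]

lemma extractFlips_pairSwap {U : Type*} {e : U → ℕ} (he : Function.Injective e) (x : ℕ → U)
    (r : ℕ → Bool) (n : ℕ) [DecidablePred fun n => x (3 * n + 1) ≠ x (3 * n + 2)]
    {ν : ℕ → ℕ} (hν : ν = Nat.nth fun n => x (3 * n + 1) ≠ x (3 * n + 2)) :
    extractFlips e (x ∘ pairSwap r) n =
      List.ofFn fun j : Fin (Nat.count (fun n => x (3 * n + 1) ≠ x (3 * n + 2)) n) =>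
        (x (3 * (j : ℕ)),
          (decide (e (x (3 * ν j + 1)) < e (x (3 * ν j + 2)))) ^^ r (ν j)) := by
  subst hν
  rw [extractFlips_eq_ofFn e _ (fun n => x (3 * n + 1) ≠ x (3 * n + 2)) (fun n => ?_)
    (fun n => (decide (e (x (3 * n + 1)) < e (x (3 * n + 2)))) ^^ r n) fun n hn => ?_]
  · simp only [Function.comp_apply, pairSwap_three_mul]
  · simp only [Function.comp_apply, pairSwap_one, pairSwap_two]
    cases r n <;> simp [eq_comm]
  · have hne := he.ne hn
    simp only [Function.comp_apply, pairSwap_one, pairSwap_two]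
    cases r n
    · simp
    · simp
      grind

/-- Composition with an injection of the index set preserves i.i.d. product measures. -/
lemma infinitePi_map_comp_injective {ι κ V : Type*} [MeasurableSpace V] (P : Measure V)
    [IsProbabilityMeasure P] {σ : ι → κ} (hσ : Function.Injective σ) :
    (Measure.infinitePi fun _ : κ => P).map (fun x => x ∘ σ) =
      Measure.infinitePi fun _ : ι => P := by
  classical
  refine Measure.eq_infinitePi _ fun s t ht => ?_
  rw [Measure.map_apply (by fun_prop)
    (MeasurableSet.pi s.countable_toSet fun i _ => ht i)]
  rcases isEmpty_or_nonempty ι with hι | hι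
  · have : s = ∅ := Finset.eq_empty_of_isEmpty s
    subst this
    simp
  have : (fun x : κ → V => x ∘ σ) ⁻¹' Set.pi s t =
      Set.pi (s.image σ : Finset κ) fun k => t (Function.invFun σ k) := by
    ext x
    simp [Set.mem_pi, Function.leftInverse_invFun hσ _]
  rw [this, Measure.infinitePi_pi _ fun i _ => ht _, Finset.prod_image fun a _ b _ h => hσ h]
  exact Finset.prod_congr rfl fun i _ => by rw [Function.leftInverse_invFun hσ i]

lemma IsIIDProduct.eq_infinitePi {U : Type*} [MeasurableSpace U] {D : Measure U}
    [IsProbabilityMeasure D] {μ : Measure (ℕ → U)} (h : IsIIDProduct D μ) :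
    μ = Measure.infinitePi fun _ => D := by
  classical
  refine Measure.eq_infinitePi _ fun s t _ => ?_
  have hs : ∀ i ∈ s, i < s.sup id + 1 := fun i hi => Nat.lt_succ_of_le (Finset.le_sup (f := id) hi)
  have := h.2 (s.sup id + 1) fun j => if (j : ℕ) ∈ s then t j else Set.univ
  have heq : Set.pi s t =
      {f : ℕ → U | ∀ j : Fin (s.sup id + 1), f j ∈ if (j : ℕ) ∈ s then t j else Set.univ} := by
    ext f
    simp only [Set.mem_pi, Finset.mem_coe, Set.mem_ofPred_eq]
    constructor
    · intro hf j
      split_ifs with hj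
      exacts [hf _ hj, trivial]
    · intro hf i hi
      simpa [hi] using hf ⟨i, hs i hi⟩
  rw [heq, this, Fin.prod_univ_eq_prod_range (fun j => D (if j ∈ s then t j else Set.univ))]
  rw [← Finset.prod_subset (s₁ := s) fun i hi => Finset.mem_range.2 (hs i hi)]
  · exact Finset.prod_congr rfl fun i hi => by rw [if_pos hi]
  · intro i _ hi
    simp [hi]

/-- A pair of atoms occurs infinitely often in the last two entries of the blocks of a sample. -/
lemma ae_frequently_pair {U : Type*} [MeasurableSpace U] [MeasurableSingletonClass U]
    (D : Measure U) [IsProbabilityMeasure D] {a b : U} (ha : D {a} ≠ 0) (hb : D {b} ≠ 0) :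
    ∀ᵐ x ∂Measure.infinitePi fun _ : ℕ => D,
      ∃ᶠ n in Filter.atTop, x (3 * n + 1) = a ∧ x (3 * n + 2) = b := by
  classical
  set μ := Measure.infinitePi fun _ : ℕ => D
  let f : ℕ → Set (ℕ → U) := fun n => {x | x (3 * n + 1) = a ∧ x (3 * n + 2) = b}
  have hf : ∀ n, MeasurableSet (f n) := fun n =>
    MeasurableSet.inter
      ((measurable_pi_apply (3 * n + 1) : Measurable fun x : ℕ → U => x (3 * n + 1))
        (measurableSet_singleton a))
      ((measurable_pi_apply (3 * n + 2) : Measurable fun x : ℕ → U => x (3 * n + 2))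
        (measurableSet_singleton b))
  have hprod : ∀ s : Finset ℕ, μ (⋂ i ∈ s, f i) = ∏ _i ∈ s, D {a} * D {b} := by
    intro s
    have hset : (⋂ i ∈ s, f i) = Set.pi
        (s.image (fun n => 3 * n + 1) ∪ s.image (fun n => 3 * n + 2) : Finset ℕ)
        fun i => if i % 3 = 1 then {a} else {b} := by
      have h1 : ∀ n, (3 * n + 1) % 3 = 1 := by omega
      have h2 : ∀ n, (3 * n + 2) % 3 = 2 := by omega
      ext x
      simp only [Set.mem_iInter, f, Set.mem_ofPred_eq, Set.mem_pi, Finset.mem_coe,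
        Finset.mem_union, Finset.mem_image]
      constructor
      · rintro h i (⟨n, hn, rfl⟩ | ⟨n, hn, rfl⟩)
        · simpa [h1] using (h n hn).1
        · simpa [h2] using (h n hn).2
      · intro h n hn
        exact ⟨by simpa [h1] using h _ (Or.inl ⟨n, hn, rfl⟩),
          by simpa [h2] using h _ (Or.inr ⟨n, hn, rfl⟩)⟩
    rw [hset, Measure.infinitePi_pi, Finset.prod_union, Finset.prod_image, Finset.prod_image,
      Finset.prod_mul_distrib]
    · congr 1 <;> refine Finset.prod_congr rfl fun i _ => ?_
      · rw [if_pos (by omega)]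
      · rw [if_neg (by omega)]
    · intro i _ j _ h
      dsimp only at h
      omega
    · intro i _ j _ h
      dsimp only at h
      omega
    · rw [Finset.disjoint_left]
      intro i hi hj
      simp only [Finset.mem_image] at hi hj
      omega
    · intro i _
      split_ifs <;> exact measurableSet_singleton _
  have hone : ∀ n, μ (f n) = D {a} * D {b} := fun n => by simpa using hprod {n}
  have hind : ProbabilityTheory.iIndepSet f μ := by
    rw [ProbabilityTheory.iIndepSet_iff_meas_biInter hf]
    intro s
    simp only [hprod, hone]
  have hlim := ProbabilityTheory.measure_limsup_eq_one hf hind (by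
    simp only [hone]
    exact ENNReal.tsum_const_eq_top_of_ne_zero (mul_ne_zero ha hb))
  have hae := (prob_compl_eq_zero_iff (MeasurableSet.measurableSet_limsup hf)).2 hlim
  have hae' : ∀ᵐ x ∂μ, x ∈ Filter.limsup f Filter.atTop := hae
  filter_upwards [hae'] with x hx
  exact Filter.mem_limsup_iff_frequently_mem.1 hx

/-- Almost every sample from a distribution valid for `L` enumerates `L`. -/
lemma IsValidFor.ae_isEnumeration {U : Type*} [Countable U] [MeasurableSpace U]
    [MeasurableSingletonClass U] {D : Measure U} [IsProbabilityMeasure D] {L : Set U}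
    (hD : IsValidFor D L) : ∀ᵐ x ∂Measure.infinitePi fun _ : ℕ => D, IsEnumeration L x := by
  have hL : ∀ᵐ u ∂D, u ∈ L := by
    rw [ae_iff_of_countable]
    exact fun u hu => (hD.2 u).1 (pos_iff_ne_zero.2 hu)
  have h1 : ∀ᵐ x ∂Measure.infinitePi fun _ : ℕ => D, ∀ n, x n ∈ L := by
    rw [ae_all_iff]
    intro n
    exact (measurePreserving_eval_infinitePi (fun _ : ℕ => D) n).quasiMeasurePreserving.ae hL
  have h2 : ∀ᵐ x ∂Measure.infinitePi fun _ : ℕ => D, ∀ u ∈ L, ∃ n, x n = u := by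
    rw [ae_all_iff]
    intro u
    by_cases hu : u ∈ L
    · have hu' := ((hD.2 u).2 hu).ne'
      filter_upwards [ae_frequently_pair D hu' hu'] with x hx _
      obtain ⟨n, hn⟩ := hx.exists
      exact ⟨_, hn.1⟩
    · exact Filter.Eventually.of_forall fun x h => absurd h hu
  filter_upwards [h1, h2] with x hx hx' using ⟨hx, hx'⟩

/-- Flipping a fixed set of coins, along an injection, turns fair coins into fair coins. -/
lemma isBernoulliProduct_map_xor {P : Measure Bool} [IsProbabilityMeasure P]
    (hP : ∀ b, P {b} = 2⁻¹) {ν : ℕ → ℕ} (hν : Function.Injective ν) (c : ℕ → Bool) :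
    IsBernoulliProduct ((Measure.infinitePi fun _ : ℕ => P).map
      fun r m => c m ^^ r (ν m)) := by
  have hm : Measurable fun (r : ℕ → Bool) m => c m ^^ r (ν m) :=
    measurable_pi_lambda _ fun m =>
      (measurable_of_finite (fun b => c m ^^ b)).comp (measurable_pi_apply _)
  refine ⟨Measure.isProbabilityMeasure_map hm.aemeasurable, fun t b => ?_⟩
  have hset : {r : ℕ → Bool | ∀ j : Fin t, r j = b j} =
      ⋂ j : Fin t, (fun r : ℕ → Bool => r j) ⁻¹' {b j} := by
    ext r
    simp
  rw [Measure.map_apply hm (by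
    rw [hset]
    exact MeasurableSet.iInter fun j => measurable_pi_apply _ (measurableSet_singleton _))]
  let g : ℕ → Set Bool := fun m => if h : m < t then {c m ^^ b ⟨m, h⟩} else Set.univ
  have hpre : (fun (r : ℕ → Bool) m => c m ^^ r (ν m)) ⁻¹' {r | ∀ j : Fin t, r j = b j} =
      (fun r : ℕ → Bool => r ∘ ν) ⁻¹' Set.pi (Finset.range t) g := by
    ext r
    simp only [Set.mem_preimage, Set.mem_ofPred_eq, Set.mem_pi, Finset.mem_coe, Finset.mem_range,
      Function.comp_apply]
    have hx : ∀ u v w : Bool, (u ^^ v) = w ↔ v = (u ^^ w) := by decide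
    constructor
    · intro h m hmt
      simp only [g, hmt, dif_pos, Set.mem_singleton_iff]
      exact (hx _ _ _).1 (h ⟨m, hmt⟩)
    · intro h j
      have := h j j.2
      simp only [g, j.2, dif_pos, Set.mem_singleton_iff] at this
      exact (hx _ _ _).2 this
  rw [hpre, ← Measure.map_apply (by fun_prop)
    (MeasurableSet.pi (Finset.countable_toSet _) fun i _ => MeasurableSet.of_discrete),
    infinitePi_map_comp_injective P hν, Measure.infinitePi_pi _ fun i _ => MeasurableSet.of_discrete]
  rw [Finset.prod_congr rfl (g := fun _ => (2 : ENNReal)⁻¹)]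
  · simp
  · intro i hi
    simp only [g, Finset.mem_range.1 hi, dif_pos, hP]

/-- Eventual properties of the finite prefixes of a sequence in a countable type are measurable. -/
lemma measurableSet_eventually_ofFn {V : Type*} [Countable V] [MeasurableSpace V]
    [MeasurableSingletonClass V] (S : ∀ t : ℕ, (Fin t → V) → Prop) :
    MeasurableSet {x : ℕ → V | ∃ tStar : ℕ, ∀ t ≥ tStar, S t fun j => x j} := by
  have : {x : ℕ → V | ∃ tStar : ℕ, ∀ t ≥ tStar, S t fun j => x j} =
      ⋃ tStar : ℕ, ⋂ t : ℕ, ⋂ _ : t ≥ tStar,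
        (fun (x : ℕ → V) (j : Fin t) => x j) ⁻¹' {y | S t y} := by
    ext x
    simp
  rw [this]
  refine MeasurableSet.iUnion fun _ => MeasurableSet.iInter fun t => MeasurableSet.iInter fun _ => ?_
  have hm : Measurable fun (x : ℕ → V) (j : Fin t) => x j :=
    measurable_pi_lambda _ fun j => measurable_pi_apply _
  exact hm (Set.to_countable _).measurableSet

lemma exists_fair_coin : ∃ P : Measure Bool, IsProbabilityMeasure P ∧ ∀ b, P {b} = 2⁻¹ := by
  refine ⟨(PMF.uniformOfFintype Bool).toMeasure, inferInstance, fun b => ?_⟩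
  rw [PMF.toMeasure_apply_singleton _ _ (measurableSet_singleton b)]
  simp

/-- If `x` contains infinitely many unequal pairs and its first entries enumerate `C z`, then
randomly swapping the pairs makes the derandomized identifier succeed with probability `p`. -/
lemma le_measure_derandomize_pairSwap {U : Type*} [Inhabited U] {C : ℕ → Set U} {k : ℕ}
    {B : List (U × Bool) → Finset ℕ} {p : ENNReal} (hB : ProbIdentifiesInLimit C k B p)
    {e : U → ℕ} (he : Function.Injective e) {P : Measure Bool} [IsProbabilityMeasure P]
    (hP : ∀ b, P {b} = 2⁻¹) {z : ℕ} {x : ℕ → U}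
    (hx : IsEnumeration (C z) fun n => x (3 * n))
    (hinf : ∃ᶠ n in Filter.atTop, x (3 * n + 1) ≠ x (3 * n + 2)) :
    p ≤ Measure.infinitePi (fun _ : ℕ => P) {r | ∃ tStar : ℕ, ∀ t ≥ tStar,
      ∃ i ∈ derandomize C B e (prefixList (x ∘ pairSwap r) t), C i = C z} := by
  classical
  have hinf' : (Set.ofPred fun n => x (3 * n + 1) ≠ x (3 * n + 2)).Infinite :=
    Nat.frequently_atTop_iff_infinite.1 hinf
  obtain ⟨ν, hν⟩ : ∃ ν, ν = Nat.nth fun n => x (3 * n + 1) ≠ x (3 * n + 2) := ⟨_, rfl⟩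
  have hνinj : Function.Injective ν := hν ▸ Nat.nth_injective hinf'
  have hm : Measurable fun (r : ℕ → Bool) m =>
      (decide (e (x (3 * ν m + 1)) < e (x (3 * ν m + 2)))) ^^ r (ν m) :=
    measurable_pi_lambda _ fun m =>
      (measurable_of_finite (fun b => _ ^^ b)).comp (measurable_pi_apply _)
  have h := hB.2 z _ hx _ (isBernoulliProduct_map_xor hP hνinj
    fun m => decide (e (x (3 * ν m + 1)) < e (x (3 * ν m + 2))))
  rw [Measure.map_apply hm (measurableSet_eventually_ofFn fun t r =>
    ∃ i ∈ B (List.ofFn fun j : Fin t => (x (3 * (j : ℕ)), r j)), C i = C z)] at h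
  refine h.trans (measure_mono ?_)
  rintro r ⟨tStar, ht⟩
  obtain ⟨n, hn⟩ := hinf.exists
  refine ⟨max (3 * n + 3) (3 * ν tStar), fun t htt => ?_⟩
  have hne : (x ∘ pairSwap r) (3 * n + 1) ≠ (x ∘ pairSwap r) (3 * n + 2) := by
    simp only [Function.comp_apply, pairSwap_one, pairSwap_two]
    cases r n <;> simp [hn, hn.symm]
  rw [derandomize_prefixList C B e (by omega) (by omega) hne, extractFlips_pairSwap he x r _ hν]
  refine ht _ ?_
  have h1 : ν tStar ≤ t / 3 := by omega
  calc tStar = Nat.count (fun n => x (3 * n + 1) ≠ x (3 * n + 2)) (ν tStar) := by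
        rw [hν, Nat.count_nth_of_infinite hinf']
    _ ≤ _ := Nat.count_monotone _ h1

/-- If some probabilistic `k`-list identifier identifies `C` in the limit
with probability `p`, then some deterministic `k`-list identifier identifies `C` in the
limit with probability `p` on infinite draws. -/
theorem probabilistic_to_draws {U : Type*} [Countable U] [MeasurableSpace U]
    [MeasurableSingletonClass U]
    (C : ℕ → Set U) (hC : ∀ i, (C i).Nonempty) (k : ℕ) (hk : 1 ≤ k)
    (p : ENNReal) (hp : p ≤ 1)
    (h : ∃ B : List (U × Bool) → Finset ℕ, ProbIdentifiesInLimit C k B p) :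
    ∃ A : List U → Finset ℕ, IdentifiesOnDraws C k A p := by
  obtain ⟨B, hB⟩ := h
  obtain ⟨e, he⟩ := Countable.exists_injective_nat U
  have : Inhabited U := ⟨(hC 0).some⟩
  refine ⟨derandomize C B e, card_derandomize_le hk hB.1 e, fun z D hD μ hμ => ?_⟩
  have := hD.1
  obtain rfl := hμ.eq_infinitePi
  rcases (C z).subsingleton_or_nontrivial with hz | ⟨a, ha, b, hb, hab⟩
  · refine hp.trans (measure_univ.ge.trans (measure_mono_ae ?_))
    filter_upwards [hD.ae_isEnumeration] with x hx _
    exact ⟨1, fun t ht => derandomize_of_subsingleton B e hz hx ht⟩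
  obtain ⟨P, hPprob, hP⟩ := exists_fair_coin
  set G : Set (ℕ → U) := {x | ∃ tStar : ℕ, ∀ t ≥ tStar,
    ∃ i ∈ derandomize C B e (prefixList x t), C i = C z} with hG
  have hGm : MeasurableSet G := measurableSet_eventually_ofFn fun t y =>
    ∃ i ∈ derandomize C B e (List.ofFn y), C i = C z
  set μ := Measure.infinitePi fun _ : ℕ => D
  set ρ := Measure.infinitePi fun _ : ℕ => P
  have hT : Measurable fun q : (ℕ → Bool) × (ℕ → U) => q.2 ∘ pairSwap q.1 := by
    refine measurable_pi_lambda _ fun n => ?_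
    have hr : MeasurableSet {q : (ℕ → Bool) × (ℕ → U) | q.1 (n / 3) = true} :=
      ((measurable_pi_apply (n / 3)).comp measurable_fst :
        Measurable fun q : (ℕ → Bool) × (ℕ → U) => q.1 (n / 3)) (measurableSet_singleton true)
    have : (fun q : (ℕ → Bool) × (ℕ → U) => (q.2 ∘ pairSwap q.1) n) = fun q =>
        if q.1 (n / 3) = true then q.2 (pairSwap (fun _ => true) n) else q.2 n := by
      funext q
      by_cases hq : q.1 (n / 3) <;> simp [pairSwap, hq]
    rw [this]
    exact Measurable.ite hr (by fun_prop) (by fun_prop)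
  have hfix : ∀ r, μ ((fun x => x ∘ pairSwap r) ⁻¹' G) = μ G := fun r => by
    rw [← Measure.map_apply (by fun_prop) hGm,
      infinitePi_map_comp_injective D (pairSwap_involutive r).injective]
  have hae : ∀ᵐ x ∂μ, p ≤ ρ {r | x ∘ pairSwap r ∈ G} := by
    have h3 : MeasurePreserving (fun x : ℕ → U => x ∘ fun n => 3 * n) μ μ :=
      ⟨by fun_prop, infinitePi_map_comp_injective D fun m n h => by simpa using h⟩
    filter_upwards [h3.quasiMeasurePreserving.ae hD.ae_isEnumeration,
      ae_frequently_pair D ((hD.2 a).2 ha).ne' ((hD.2 b).2 hb).ne'] with x hx hx'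
    exact le_measure_derandomize_pairSwap hB he hP hx
      (hx'.mono fun n hn => by rw [hn.1, hn.2]; exact hab)
  calc p = ∫⁻ _, p ∂μ := by simp
    _ ≤ ∫⁻ x, ρ {r | x ∘ pairSwap r ∈ G} ∂μ := lintegral_mono_ae hae
    _ = (ρ.prod μ) ((fun q : (ℕ → Bool) × (ℕ → U) => q.2 ∘ pairSwap q.1) ⁻¹' G) :=
        (Measure.prod_apply_symm (hT hGm)).symm
    _ = ∫⁻ r, μ ((fun x => x ∘ pairSwap r) ⁻¹' G) ∂ρ := Measure.prod_apply (hT hGm)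
    _ = μ G := by simp [hfix]
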